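/- arXiv:math/9702231 — 2 statements merged into one kernel-verified Lean document; each statement's English description precedes it below -/
import Mathlib

section
/- Let V be a set and let S be a family of subsets of V such that for every pair of points u, v ∈ V the collection {U ∈ S : u ∈ U and v ∉ U} is finite. Define D : V × V → ℝ by D(u,v) = the number of sets U ∈ S with u ∈ U and v ∉ U. Then D is a conditionally negative kernel on V: for every finite list of points u₁, …, uₙ ∈ V and real numbers λ₁, …, λₙ with Σᵢ λᵢ = 0, one has Σᵢ Σⱼ λᵢ λⱼ D(uᵢ, uⱼ) ≤ 0. -/
open Finset

/-- The "separation count" kernel: the number of sets `U ∈ S` containing `u` but not `v`. -/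
noncomputable def sepCount {V : Type*} (S : Set (Set V)) (u v : V) : ℝ :=
  Set.ncard {U | U ∈ S ∧ u ∈ U ∧ v ∉ U}

/-- The separation count is the sum, over any finite set of members of `S` containing all those
that separate `u` from `v`, of `χ_U(u) (1 - χ_U(v))`. -/
theorem sepCount_eq_sum_indicator {V : Type*} {S : Set (Set V)} {T : Finset (Set V)} {u v : V}
    (hTS : ∀ U ∈ T, U ∈ S) (hT : ∀ U ∈ S, u ∈ U → v ∉ U → U ∈ T) :
    sepCount S u v =
      ∑ U ∈ T, U.indicator (1 : V → ℝ) u * (1 - U.indicator (1 : V → ℝ) v) := by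
  classical
  have hset : {U | U ∈ S ∧ u ∈ U ∧ v ∉ U} = ↑(T.filter fun U => u ∈ U ∧ v ∉ U) := by
    ext U
    simp only [Set.mem_ofPred_eq, coe_filter]
    exact ⟨fun h => ⟨hT U h.1 h.2.1 h.2.2, h.2⟩, fun h => ⟨hTS U h.1, h.2⟩⟩
  rw [sepCount, hset, Set.ncard_coe_finset, card_filter, Nat.cast_sum]
  refine sum_congr rfl fun U _ => ?_
  by_cases hu : u ∈ U <;> by_cases hv : v ∈ U <;> simp [hu, hv]

/-- For weights summing to zero, the quadratic form of the kernel `f i * (1 - f j)` is minus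
the square of the weighted sum of `f`. -/
theorem sum_sum_mul_mul_one_sub {ι : Type*} [Fintype ι] (lam f : ι → ℝ)
    (hlam : ∑ i, lam i = 0) :
    ∑ i, ∑ j, lam i * lam j * (f i * (1 - f j)) = -(∑ i, lam i * f i) ^ 2 := by
  calc
    _ = (∑ i, lam i * f i) * ∑ j, (lam j - lam j * f j) := by
      rw [sum_mul_sum]
      exact sum_congr rfl fun i _ => sum_congr rfl fun j _ => by ring
    _ = _ := by
      rw [sum_sub_distrib, hlam]
      ring

/-- If for every pair `u, v` only finitely many sets of `S` separate them, then the
separation-count function `D(u,v) = #{U ∈ S : u ∈ U, v ∉ U}` is a conditionally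
negative kernel on `V`. -/
theorem sepCount_isCondNegKernel {V : Type*} (S : Set (Set V))
    (hfin : ∀ u v : V, {U | U ∈ S ∧ u ∈ U ∧ v ∉ U}.Finite) :
    ∀ (n : ℕ) (u : Fin n → V) (lam : Fin n → ℝ), (∑ i, lam i) = 0 →
      ∑ i, ∑ j, lam i * lam j * sepCount S (u i) (u j) ≤ 0 := by
  intro n u lam hlam
  have hfinite : (⋃ i, ⋃ j, {U | U ∈ S ∧ u i ∈ U ∧ u j ∉ U}).Finite :=
    Set.finite_iUnion fun i => Set.finite_iUnion fun j => hfin (u i) (u j)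
  have hsum (i j : Fin n) := sepCount_eq_sum_indicator (S := S) (T := hfinite.toFinset)
    (u := u i) (v := u j) (by simp +contextual) fun U hU hi hj =>
      hfinite.mem_toFinset.2 (Set.mem_iUnion₂.2 ⟨i, j, hU, hi, hj⟩)
  simp_rw [hsum, mul_sum]
  rw [sum_congr rfl fun i _ => sum_comm, sum_comm]
  refine sum_nonpos fun U _ => ?_
  rw [sum_sum_mul_mul_one_sub lam (fun i => U.indicator (1 : V → ℝ) (u i)) hlam]
  exact neg_nonpos.mpr (sq_nonneg _)
end

section
/- Let T be a tree, i.e. a connected simple graph with no cycles, on a vertex set V. Then the graph distance d : V × V → ℝ (the length of the shortest edge path between two vertices) is a conditionally negative kernel on V: for every finite list of vertices u₁, …, uₙ and real numbers λ₁, …, λₙ with Σᵢ λᵢ = 0, one has Σᵢ Σⱼ λᵢ λⱼ d(uᵢ, uⱼ) ≤ 0. -/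
open Finset

/-- The indicator of the pairs separated by a map is conditionally negative. -/
theorem sum_sum_mul_ite_eq_nonpos {ι α : Type*} [Fintype ι] [DecidableEq α] (c : ι → α)
    (lam : ι → ℝ) (hlam : ∑ i, lam i = 0) :
    ∑ i, ∑ j, lam i * lam j * (if c i = c j then 0 else 1) ≤ 0 := by
  have hsep : ∀ i j, lam i * lam j * (if c i = c j then 0 else 1) =
      lam i * lam j - ∑ a ∈ univ.image c,
        (if c i = a then lam i else 0) * (if c j = a then lam j else 0) := by
    intro i j
    simp only [ite_mul, zero_mul]
    rw [Finset.sum_ite_eq, if_pos (mem_image_of_mem c (mem_univ i))]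
    split_ifs <;> simp_all
  have hsum : ∑ i, ∑ j, lam i * lam j * (if c i = c j then 0 else 1) =
      -∑ a ∈ univ.image c, (∑ i, if c i = a then lam i else 0) ^ 2 := by
    simp only [hsep, sum_sub_distrib]
    rw [← sum_mul_sum, hlam, zero_mul, zero_sub]
    simp_rw [sq, sum_mul_sum]
    rw [sum_comm (s := univ.image c)]
    exact congrArg Neg.neg (sum_congr rfl fun i _ => sum_comm)
  rw [hsum, neg_nonpos]
  exact sum_nonneg fun _ _ => sq_nonneg _

/-- An edge lies on a path of an acyclic graph iff deleting it separates the endpoints. -/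
theorem SimpleGraph.IsAcyclic.mem_edges_iff_not_reachable_deleteEdges {V : Type*}
    {G : SimpleGraph V} (hG : G.IsAcyclic) {u v : V} {p : G.Walk u v} (hp : p.IsPath)
    (e : Sym2 V) : e ∈ p.edges ↔ ¬ (G.deleteEdges {e}).Reachable u v := by
  classical
  induction e with | h a b
  rw [SimpleGraph.reachable_deleteEdges_iff_exists_walk, not_exists]
  refine ⟨fun he q hq => hq ?_, fun h => not_not.mp (h p)⟩
  have hpq : p = q.bypass :=
    congrArg Subtype.val ((hG.subsingleton_path u v).elim ⟨p, hp⟩ ⟨q.bypass, q.bypass_isPath⟩)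
  exact q.edges_bypass_subset_edges (hpq ▸ he)

/-- The graph distance on a tree (a connected acyclic simple graph) is a conditionally
negative kernel on the vertex set. -/
theorem tree_dist_isCondNegKernel {V : Type*} (T : SimpleGraph V)
    (hconn : T.Connected) (hacyc : T.IsAcyclic) :
    ∀ (n : ℕ) (u : Fin n → V) (lam : Fin n → ℝ), (∑ i, lam i) = 0 →
      ∑ i, ∑ j, lam i * lam j * (T.dist (u i) (u j) : ℝ) ≤ 0 := by
  classical
  intro n u lam hlam
  choose p hp hlen using fun i j => hconn.exists_path_of_dist (u i) (u j)
  let F : Finset (Sym2 V) := univ.biUnion fun i => univ.biUnion fun j => (p i j).edges.toFinset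
  let comp (e : Sym2 V) (i : Fin n) := (T.deleteEdges {e}).connectedComponentMk (u i)
  have hdist : ∀ i j, (T.dist (u i) (u j) : ℝ) =
      ∑ e ∈ F, if comp e i = comp e j then 0 else 1 := by
    intro i j
    have hfilter : (p i j).edges.toFinset = F.filter fun e => ¬ comp e i = comp e j := by
      ext e
      simp only [F, comp, mem_filter, mem_biUnion, mem_univ, true_and, List.mem_toFinset,
        SimpleGraph.ConnectedComponent.eq,
        ← hacyc.mem_edges_iff_not_reachable_deleteEdges (hp i j)]
      exact ⟨fun he => ⟨⟨i, j, he⟩, he⟩, And.right⟩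
    rw [← hlen i j, ← SimpleGraph.Walk.length_edges,
      ← List.toFinset_card_of_nodup (hp i j).isTrail.edges_nodup, hfilter, card_filter]
    push_cast
    exact sum_congr rfl fun e _ => ite_not _ _ _
  have hsum : ∑ i, ∑ j, lam i * lam j * (T.dist (u i) (u j) : ℝ) =
      ∑ e ∈ F, ∑ i, ∑ j, lam i * lam j * (if comp e i = comp e j then 0 else 1) := by
    simp_rw [hdist, mul_sum]
    rw [sum_comm (s := F)]
    exact sum_congr rfl fun i _ => sum_comm
  rw [hsum]
  exact sum_nonpos fun e _ => sum_sum_mul_ite_eq_nonpos (comp e) lam hlam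
end
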